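/- Let F(x,z,t) be the free group on three generators x, z, t, let F(x,z) be the free group on x, z (regarded as a subgroup of F(x,z,t) via the inclusion of generators), and let F(x,y) be the free group on x, y. Fix a subset s of F(x,z), an element w of F(x,z), and an integer n, and let σ : F(x,z) → F(x,y) be the homomorphism with σ(x) = x and σ(z) = y⁻¹xⁿy. Then the group presented by ⟨x, z, t | s, t⁻¹xⁿt·(w z w⁻¹)⁻¹⟩ is isomorphic to the group presented by ⟨x, y | σ(s)⟩. -/

import Mathlib

/-- The free group `F(x,z)` (also serving as `F(x,y)`) on two generators:
generator `0` is `x`, generator `1` is `z` (respectively `y`). -/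
abbrev F2 : Type := FreeGroup (Fin 2)

/-- The free group `F(x,z,t)` on three generators: `0 ↦ x`, `1 ↦ z`, `2 ↦ t`. -/
abbrev F3 : Type := FreeGroup (Fin 3)

/-- The inclusion `F(x,z) → F(x,z,t)` induced by the inclusion of generators. -/
def ι : F2 →* F3 := FreeGroup.map (Fin.castLE (by omega))

/-- The homomorphism `σ : F(x,z) → F(x,y)` with `σ(x) = x` and `σ(z) = y⁻¹xⁿy`. -/
def σ (n : ℤ) : F2 →* F2 :=
  FreeGroup.lift fun i : Fin 2 =>
    if i = 0 then FreeGroup.of 0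
    else (FreeGroup.of 1)⁻¹ * (FreeGroup.of 0) ^ n * FreeGroup.of 1

@[simp]
theorem ι_of_zero : ι (FreeGroup.of 0) = FreeGroup.of 0 := rfl

@[simp]
theorem ι_of_one : ι (FreeGroup.of 1) = FreeGroup.of 1 := rfl

@[simp]
theorem σ_of_zero (n : ℤ) : σ n (FreeGroup.of 0) = FreeGroup.of 0 := by simp [σ]

@[simp]
theorem σ_of_one (n : ℤ) :
    σ n (FreeGroup.of 1) = (FreeGroup.of 1)⁻¹ * (FreeGroup.of 0) ^ n * FreeGroup.of 1 := by
  simp [σ]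

/-- A homomorphism on `F(x,z,t)` that agrees with `φ` on `x` and `z` extends `φ` along `ι`. -/
theorem lift_comp_ι {G : Type*} [Group G] (φ : F2 →* G) (c : G) :
    (FreeGroup.lift ![φ (FreeGroup.of 0), φ (FreeGroup.of 1), c]).comp ι = φ := by
  ext i
  fin_cases i <;> simp

/-- A homomorphism on `F(x,y)` sending `x` to `ψ x` and conjugating `ψ x ^ n` to `ψ z` by the image
of `y` extends `ψ` along `σ n`. -/
theorem lift_comp_σ {G : Type*} [Group G] (n : ℤ) (ψ : F2 →* G) (c : G)
    (h : c⁻¹ * ψ (FreeGroup.of 0) ^ n * c = ψ (FreeGroup.of 1)) :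
    (FreeGroup.lift ![ψ (FreeGroup.of 0), c]).comp (σ n) = ψ := by
  ext i
  fin_cases i
  · simp
  · simpa using h

/-- `⟨x, z, t | s, t⁻¹xⁿt (w z w⁻¹)⁻¹⟩` is isomorphic to `⟨x, y | σ(s)⟩`, where
`σ(x) = x` and `σ(z) = y⁻¹xⁿy`. -/
theorem presented_three_gen_iso (s : Set F2) (w : F2) (n : ℤ) :
    Nonempty (PresentedGroup
        (ι '' s ∪ {(FreeGroup.of 2)⁻¹ * (FreeGroup.of 0 : F3) ^ n * FreeGroup.of 2 *
          (ι w * FreeGroup.of 1 * (ι w)⁻¹)⁻¹}) ≃*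
      PresentedGroup (σ n '' s)) := by
  set R : Set F3 := ι '' s ∪ {(FreeGroup.of 2)⁻¹ * (FreeGroup.of 0 : F3) ^ n * FreeGroup.of 2 *
    (ι w * FreeGroup.of 1 * (ι w)⁻¹)⁻¹}
  let φ : F2 →* PresentedGroup (σ n '' s) := (PresentedGroup.mk _).comp (σ n)
  let ψ : F2 →* PresentedGroup R := (PresentedGroup.mk R).comp ι
  let y : PresentedGroup (σ n '' s) := PresentedGroup.of 1
  let t : PresentedGroup R := PresentedGroup.of 2
  have hφz : φ (FreeGroup.of 1) = y⁻¹ * φ (FreeGroup.of 0) ^ n * y := by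
    simp [φ, y, PresentedGroup.of]
  have ht : t⁻¹ * ψ (FreeGroup.of 0) ^ n * t = ψ w * ψ (FreeGroup.of 1) * (ψ w)⁻¹ := by
    have h := PresentedGroup.mk_eq_mk_of_mul_inv_mem (rels := R) (Or.inr rfl)
    simpa [ψ, t, PresentedGroup.of] using h
  have hψz : (t * ψ w)⁻¹ * ψ (FreeGroup.of 0) ^ n * (t * ψ w) = ψ (FreeGroup.of 1) := by
    calc _ = (ψ w)⁻¹ * (t⁻¹ * ψ (FreeGroup.of 0) ^ n * t) * ψ w := by group
      _ = _ := by rw [ht]; group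
  let f : Fin 3 → PresentedGroup (σ n '' s) :=
    ![φ (FreeGroup.of 0), φ (FreeGroup.of 1), y * (φ w)⁻¹]
  let g : Fin 2 → PresentedGroup R := ![ψ (FreeGroup.of 0), t * ψ w]
  have hfι (u : F2) : FreeGroup.lift f (ι u) = φ u :=
    DFunLike.congr_fun (lift_comp_ι φ (y * (φ w)⁻¹)) u
  have hgσ (u : F2) : FreeGroup.lift g (σ n u) = ψ u :=
    DFunLike.congr_fun (lift_comp_σ n ψ (t * ψ w) hψz) u
  have hf : ∀ r ∈ R, FreeGroup.lift f r = 1 := by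
    rintro r (⟨u, hu, rfl⟩ | rfl)
    · rw [hfι]
      exact PresentedGroup.one_of_mem ⟨u, hu, rfl⟩
    · simp only [map_mul, map_inv, map_zpow, hfι, FreeGroup.lift_apply_of]
      change (y * (φ w)⁻¹)⁻¹ * φ (FreeGroup.of 0) ^ n * (y * (φ w)⁻¹) *
        (φ w * φ (FreeGroup.of 1) * (φ w)⁻¹)⁻¹ = 1
      rw [hφz]
      group
  have hg : ∀ r ∈ σ n '' s, FreeGroup.lift g r = 1 := by
    rintro _ ⟨u, hu, rfl⟩
    rw [hgσ]
    exact PresentedGroup.one_of_mem (Or.inl ⟨u, hu, rfl⟩)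
  let Φ := PresentedGroup.toGroup hf
  let Ψ := PresentedGroup.toGroup hg
  have hΦψ (u : F2) : Φ (ψ u) = φ u := hfι u
  have hΨφ (u : F2) : Ψ (φ u) = ψ u := hgσ u
  have hΦt : Φ t = y * (φ w)⁻¹ := PresentedGroup.toGroup.of hf
  have hΨy : Ψ y = t * ψ w := PresentedGroup.toGroup.of hg
  refine ⟨Φ.toMulEquiv Ψ ?_ ?_⟩
  · ext i
    fin_cases i
    · exact (congrArg Ψ (hΦψ (FreeGroup.of 0))).trans (hΨφ _)
    · exact (congrArg Ψ (hΦψ (FreeGroup.of 1))).trans (hΨφ _)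
    · change Ψ (Φ t) = t
      rw [hΦt, map_mul, map_inv, hΨy, hΨφ, mul_inv_cancel_right]
  · ext i
    fin_cases i
    · have hx : φ (FreeGroup.of 0) = PresentedGroup.of 0 := by simp [φ, PresentedGroup.of]
      change Φ (Ψ (PresentedGroup.of 0)) = PresentedGroup.of 0
      rw [← hx, hΨφ, hΦψ]
    · change Φ (Ψ y) = y
      rw [hΨy, map_mul, hΦt, hΦψ, inv_mul_cancel_right]
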